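/- With the notation of the main theorem (S the nullspace of A in R^n, U = Σ·W, M = d·U, q_1 | ⋯ | q_t the nonzero Smith normal form entries of K, t the rank of K, f = n − r): U = S if and only if d divides every entry of K; and S = M if and only if gcd(d, q_i) is a unit for all 1 ≤ i ≤ t and, in addition, either d is a unit or K has rank f. -/

import Mathlib

open scoped Pointwise

/-- The matrix `J = (d·I_r | K) ∈ M_{r,n}(R)`: its first `r` columns form `d·I_r`
and its last `n - r` columns form `K`. -/
noncomputable def Jmat (R : Type*) [CommRing R] (r n : ℕ) (d : R)
    (K : Matrix (Fin r) (Fin (n - r)) R) : Matrix (Fin r) (Fin n) R := fun i j =>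
  if hj : (j : ℕ) < r then (if (i : ℕ) = (j : ℕ) then d else 0)
  else K i ⟨(j : ℕ) - r, by have := j.isLt; omega⟩

/-- The vector `V(j) ∈ F^n` whose `i`-th coordinate is `-K_{i,j}/d` for `i < r`,
which is `1` in position `r + j`, and `0` elsewhere. -/
noncomputable def Vvec (R : Type*) [CommRing R] [IsDomain R] (r n : ℕ) (d : R)
    (K : Matrix (Fin r) (Fin (n - r)) R) (j : Fin (n - r)) :
    Fin n → FractionRing R := fun i =>
  if hi : (i : ℕ) < r then
    -(algebraMap R (FractionRing R) (K ⟨(i : ℕ), hi⟩ j)) / algebraMap R (FractionRing R) d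
  else if (i : ℕ) = r + (j : ℕ) then 1 else 0

/-- The coordinatewise inclusion `R^n → F^n`, as an `R`-linear map. -/
noncomputable def toFrac (R : Type*) [CommRing R] (n : ℕ) :
    (Fin n → R) →ₗ[R] (Fin n → FractionRing R) :=
  LinearMap.pi fun i => (Algebra.linearMap R (FractionRing R)).comp (LinearMap.proj i)

/-- The nullspace `N = {X ∈ R^n : JX = 0}` of `J` in `R^n`, viewed (via the inclusion
`R^n ⊆ F^n`) as an `R`-submodule of `F^n`. -/
noncomputable def Nsub (R : Type*) [CommRing R] [IsDomain R] (r n : ℕ) (d : R)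
    (K : Matrix (Fin r) (Fin (n - r)) R) : Submodule R (Fin n → FractionRing R) :=
  (LinearMap.ker (Jmat R r n d K).mulVecLin).map (toFrac R n)

/-- `W`, the `R`-span of `V(1), …, V(f)` in `F^n`. -/
noncomputable def Wsub (R : Type*) [CommRing R] [IsDomain R] (r n : ℕ) (d : R)
    (K : Matrix (Fin r) (Fin (n - r)) R) : Submodule R (Fin n → FractionRing R) :=
  Submodule.span R (Set.range (Vvec R r n d K))

section NullspaceLattice

open scoped Matrix

variable {R : Type*} [CommRing R]

/-- Splitting a sum over `Fin n` at `r ≤ n`. -/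
theorem Fin.sum_eq_sum_add_sum_sub {M : Type*} [AddCommMonoid M] {r n : ℕ} (h : r ≤ n)
    (g : Fin n → M) :
    ∑ j, g j = ∑ i : Fin r, g ⟨i, by omega⟩ + ∑ j : Fin (n - r), g ⟨r + j, by omega⟩ := by
  rw [← Equiv.sum_comp (finSumFinEquiv.trans (finCongr (Nat.add_sub_of_le h))),
    Fintype.sum_sum_type]
  rfl

theorem Matrix.dvd_mulVec {a b : Type*} [Fintype b] {d : R} (M : Matrix a b R) {z : b → R}
    (hz : ∀ j, d ∣ z j) (i : a) : d ∣ (M *ᵥ z) i :=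
  Finset.dvd_sum fun j _ => (hz j).mul_left _

theorem toFrac_apply {n : ℕ} (x : Fin n → R) (i : Fin n) :
    toFrac R n x i = algebraMap R (FractionRing R) (x i) := rfl

theorem map_mulVec_toFrac {m n : ℕ} (A : Matrix (Fin m) (Fin n) R) (x : Fin n → R) (i : Fin m) :
    (A.map (algebraMap R (FractionRing R)) *ᵥ toFrac R n x) i =
      algebraMap R (FractionRing R) ((A *ᵥ x) i) :=
  (RingHom.map_mulVec (algebraMap R (FractionRing R)) A x i).symm

theorem Jmat_mulVec {r n : ℕ} (h : r ≤ n) (d : R) (K : Matrix (Fin r) (Fin (n - r)) R)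
    (y : Fin n → R) (i : Fin r) :
    (Jmat R r n d K *ᵥ y) i =
      d * y ⟨i, by omega⟩ + (K *ᵥ fun j => y ⟨r + j, by omega⟩) i := by
  simp only [Matrix.mulVec, dotProduct]
  rw [Fin.sum_eq_sum_add_sum_sub h]
  congr 1
  · rw [Finset.sum_eq_single i]
    · simp [Jmat]
    · intro b _ hb
      have : (i : ℕ) ≠ b := fun e => hb (Fin.ext e.symm)
      simp [Jmat, this]
    · simp
  · simp [Jmat]

/-- Divisibility of `K z` by `d` forces that of `z` iff the same holds for `P K Q`, with `P` and
`Q` invertible. -/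
theorem dvd_of_dvd_mulVec_iff_of_units {a b : Type*} [Fintype a] [Fintype b] [DecidableEq a]
    [DecidableEq b] (d : R) (K : Matrix a b R) (P : (Matrix a a R)ˣ) (Q : (Matrix b b R)ˣ) :
    (∀ z, (∀ i, d ∣ (K *ᵥ z) i) → ∀ j, d ∣ z j) ↔
      ∀ z, (∀ i, d ∣ ((P.val * K * Q.val) *ᵥ z) i) → ∀ j, d ∣ z j := by
  constructor
  · intro h z hz
    have hK : ∀ i, d ∣ (K *ᵥ (Q.val *ᵥ z)) i := by
      have := Matrix.dvd_mulVec P⁻¹.val hz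
      simpa [Matrix.mulVec_mulVec, ← Matrix.mul_assoc] using this
    have := Matrix.dvd_mulVec Q⁻¹.val (h _ hK)
    simpa [Matrix.mulVec_mulVec] using this
  · intro h z hz
    have hD : ∀ i, d ∣ ((P.val * K * Q.val) *ᵥ (Q⁻¹.val *ᵥ z)) i := by
      have := Matrix.dvd_mulVec P.val hz
      simpa [Matrix.mulVec_mulVec, Matrix.mul_assoc] using this
    have := Matrix.dvd_mulVec Q.val (h _ hD)
    simpa [Matrix.mulVec_mulVec] using this

variable [IsDomain R]

theorem isCoprime_of_forall_dvd_mul [IsPrincipalIdealRing R] {d q : R} (hd : d ≠ 0)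
    (h : ∀ z, d ∣ q * z → d ∣ z) : IsCoprime d q := by
  obtain ⟨g, hg⟩ := IsPrincipalIdealRing.principal (Ideal.span {d, q})
  rw [Ideal.submodule_span_eq] at hg
  have hgd : g ∣ d := by
    rw [← Ideal.mem_span_singleton, ← hg]
    exact Ideal.subset_span (by simp)
  have hgq : g ∣ q := by
    rw [← Ideal.mem_span_singleton, ← hg]
    exact Ideal.subset_span (by simp)
  obtain ⟨d', rfl⟩ := hgd
  obtain ⟨q', rfl⟩ := hgq
  obtain ⟨c, hc⟩ := h d' ⟨q', by ring⟩
  have hd' : d' ≠ 0 := right_ne_zero_of_mul hd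
  have hu : IsUnit g := by
    refine IsUnit.of_mul_eq_one c (mul_left_cancel₀ hd' ?_)
    rw [mul_one]
    nth_rewrite 2 [hc]
    ring
  rw [← Ideal.span_singleton_eq_top, ← hg, Ideal.eq_top_iff_one, Ideal.mem_span_pair] at hu
  exact hu

/-- For a matrix with Smith normal form `diag(q)`, divisibility of `K z` by `d` forces that of `z`
iff `d` is coprime to the nonzero `q i` and either `d` is a unit or `K` has full column rank. -/
theorem dvd_of_dvd_mulVec_iff [IsPrincipalIdealRing R] {r f : ℕ} {d : R} (hd : d ≠ 0)
    (K : Matrix (Fin r) (Fin f) R)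
    (P : (Matrix (Fin r) (Fin r) R)ˣ) (Q : (Matrix (Fin f) (Fin f) R)ˣ)
    (q : Fin (min r f) → R)
    (hsnf : P.val * K * Q.val = fun (i : Fin r) (j : Fin f) =>
      if h : (i : ℕ) = (j : ℕ) then q ⟨(i : ℕ), by have := i.isLt; have := j.isLt; omega⟩
      else 0)
    (t : ℕ) (htle : t ≤ min r f) (ht : ∀ i : Fin (min r f), q i ≠ 0 ↔ (i : ℕ) < t) :
    (∀ z, (∀ i, d ∣ (K *ᵥ z) i) → ∀ j, d ∣ z j) ↔
      ((∀ i : Fin t, IsCoprime d (q (Fin.castLE htle i))) ∧ (IsUnit d ∨ t = f)) := by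
  rw [dvd_of_dvd_mulVec_iff_of_units d K P Q, hsnf]
  have hsingle (j : Fin f) (c : R) (i : Fin r) :
      (Matrix.mulVec (fun (i : Fin r) (j : Fin f) =>
        if h : (i : ℕ) = (j : ℕ) then q ⟨(i : ℕ), by have := i.isLt; have := j.isLt; omega⟩
        else 0) (Pi.single j c)) i =
      if h : (i : ℕ) = (j : ℕ) then
        q ⟨(i : ℕ), by have := i.isLt; have := j.isLt; omega⟩ * c else 0 := by
    simp only [Matrix.mulVec, dotProduct]
    rw [Finset.sum_eq_single j]
    · split_ifs <;> simp
    · intro b _ hb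
      simp [hb]
    · simp
  constructor
  · intro h
    refine ⟨fun i => isCoprime_of_forall_dvd_mul hd fun z hz => ?_, ?_⟩
    · have := h (Pi.single ⟨i, by omega⟩ z) (fun k => ?_) ⟨i, by omega⟩
      · simpa using this
      · rw [hsingle]
        split_ifs with hk
        · have hik : (⟨k, by omega⟩ : Fin (min r f)) = Fin.castLE htle i := Fin.ext hk
          rwa [hik]
        · exact dvd_zero d
    · by_cases htf : t = f
      · exact .inr htf
      · refine .inl (isUnit_of_dvd_one ?_)
        have := h (Pi.single ⟨t, by omega⟩ 1) (fun k => ?_) ⟨t, by omega⟩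
        · simpa using this
        · rw [hsingle]
          split_ifs with hk
          · have hq : q ⟨(k : ℕ), by have := k.isLt; simp only at hk; omega⟩ = 0 := by
              by_contra hne
              have := (ht _).1 hne
              simp only at this hk
              omega
            rw [hq, zero_mul]
            exact dvd_zero d
          · exact dvd_zero d
  · rintro ⟨hcop, hu | rfl⟩ z hz j
    · exact hu.dvd
    · have hj := hz ⟨j, by omega⟩
      simp only [Matrix.mulVec, dotProduct] at hj
      rw [Finset.sum_eq_single j] at hj
      · simp only [dite_true] at hj
        exact (hcop j).dvd_of_dvd_mul_left hj
      · intro b _ hb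
        have : (j : ℕ) ≠ b := fun e => hb (Fin.ext e.symm)
        simp [this]
      · simp

section

variable {r n : ℕ} {d : R} {K : Matrix (Fin r) (Fin (n - r)) R}

theorem linearCombination_Vvec_of_lt (z : Fin (n - r) → R) (i : Fin n) (hi : (i : ℕ) < r) :
    Fintype.linearCombination R (Vvec R r n d K) z i =
      -algebraMap R (FractionRing R) ((K *ᵥ z) ⟨i, hi⟩) / algebraMap R (FractionRing R) d := by
  simp only [Fintype.linearCombination_apply, Finset.sum_apply, Pi.smul_apply, Vvec, hi,
    dite_true, Matrix.mulVec, dotProduct, map_sum, map_mul, ← Finset.sum_neg_distrib,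
    Finset.sum_div]
  exact Finset.sum_congr rfl fun j _ => by rw [Algebra.smul_def]; ring

theorem linearCombination_Vvec_of_eq_add (z : Fin (n - r) → R) (i : Fin n) (j : Fin (n - r))
    (hi : (i : ℕ) = r + j) :
    Fintype.linearCombination R (Vvec R r n d K) z i = algebraMap R (FractionRing R) (z j) := by
  simp only [Fintype.linearCombination_apply, Finset.sum_apply, Pi.smul_apply, Vvec]
  rw [Finset.sum_eq_single j]
  · simp [hi, Algebra.smul_def]
  · intro b _ hb
    have : (j : ℕ) ≠ b := fun e => hb (Fin.ext e.symm)
    simp [hi, this]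
  · simp

theorem mem_Wsub {v : Fin n → FractionRing R} :
    v ∈ Wsub R r n d K ↔ ∃ z, Fintype.linearCombination R (Vvec R r n d K) z = v := by
  rw [Wsub, ← Fintype.range_linearCombination, LinearMap.mem_range]

theorem linearCombination_Vvec_injective (h : r ≤ n) :
    Function.Injective (Fintype.linearCombination R (Vvec R r n d K)) := by
  intro z z' hz
  ext j
  have := congrFun hz ⟨r + j, by omega⟩
  rw [linearCombination_Vvec_of_eq_add z _ j rfl,
    linearCombination_Vvec_of_eq_add z' _ j rfl] at this
  exact FaithfulSMul.algebraMap_injective R (FractionRing R) this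

/-- The elements of `N` are the combinations of the `V(j)` with coefficient vectors `z` such that
`d` divides `K z`. -/
theorem mem_Nsub (h : r ≤ n) (hd : d ≠ 0) {v : Fin n → FractionRing R} :
    v ∈ Nsub R r n d K ↔ ∃ z, (∀ i, d ∣ (K *ᵥ z) i) ∧
      Fintype.linearCombination R (Vvec R r n d K) z = v := by
  have hd' : algebraMap R (FractionRing R) d ≠ 0 := by simpa using hd
  simp only [Nsub, Submodule.mem_map, LinearMap.mem_ker, Matrix.mulVecLin_apply]
  constructor
  · rintro ⟨y, hy, rfl⟩
    have hyi (i : Fin r) := (Jmat_mulVec h d K y i).symm.trans (congrFun hy i)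
    simp only [Pi.zero_apply] at hyi
    refine ⟨fun j => y ⟨r + j, by omega⟩, fun i => ?_, ?_⟩
    · exact ⟨-y ⟨i, by omega⟩, by linear_combination hyi i⟩
    · ext i
      rw [toFrac_apply]
      by_cases hi : (i : ℕ) < r
      · rw [linearCombination_Vvec_of_lt _ _ hi, div_eq_iff hd', ← map_neg, ← map_mul]
        congr 1
        linear_combination -hyi ⟨i, hi⟩
      · rw [linearCombination_Vvec_of_eq_add _ i ⟨i - r, by omega⟩ (by simp; omega)]
        congr 2
        ext
        simp
        omega
  · rintro ⟨z, hz, rfl⟩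
    choose c hc using hz
    refine ⟨fun i => if hi : (i : ℕ) < r then -c ⟨i, hi⟩ else z ⟨i - r, by omega⟩, ?_, ?_⟩
    · ext i
      rw [Jmat_mulVec h]
      simp [hc]
    · ext i
      rw [toFrac_apply]
      by_cases hi : (i : ℕ) < r
      · rw [linearCombination_Vvec_of_lt _ _ hi, eq_div_iff hd', hc]
        simp [hi, mul_comm]
      · rw [linearCombination_Vvec_of_eq_add _ i ⟨i - r, by omega⟩ (by simp; omega)]
        simp [hi]

theorem Wsub_eq_Nsub_iff (h : r ≤ n) (hd : d ≠ 0) :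
    Wsub R r n d K = Nsub R r n d K ↔ ∀ i j, d ∣ K i j := by
  constructor
  · intro hWN i j
    have hj : Fintype.linearCombination R (Vvec R r n d K) (Pi.single j 1) ∈ Nsub R r n d K :=
      hWN ▸ mem_Wsub.2 ⟨_, rfl⟩
    obtain ⟨z, hz, hzj⟩ := (mem_Nsub h hd).1 hj
    rw [linearCombination_Vvec_injective h hzj] at hz
    simpa using hz i
  · intro hK
    ext v
    rw [mem_Wsub, mem_Nsub h hd]
    refine exists_congr fun z => (and_iff_right fun i => ?_).symm
    rw [Matrix.mulVec, dotProduct]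
    exact Finset.dvd_sum fun j _ => (hK i j).mul_right _

theorem Nsub_eq_smul_Wsub_iff (h : r ≤ n) (hd : d ≠ 0) :
    Nsub R r n d K = d • Wsub R r n d K ↔
      ∀ z, (∀ i, d ∣ (K *ᵥ z) i) → ∀ j, d ∣ z j := by
  constructor
  · intro hN z hz j
    have hzN := (mem_Nsub (K := K) h hd).2 ⟨z, hz, rfl⟩
    rw [hN] at hzN
    obtain ⟨w, hw, hwz⟩ := Submodule.mem_smul_pointwise_iff_exists _ _ _ |>.1 hzN
    obtain ⟨z', rfl⟩ := mem_Wsub.1 hw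
    rw [← map_smul] at hwz
    rw [← linearCombination_Vvec_injective h hwz]
    exact ⟨z' j, rfl⟩
  · intro hK
    ext v
    rw [mem_Nsub h hd, Submodule.mem_smul_pointwise_iff_exists]
    constructor
    · rintro ⟨z, hz, rfl⟩
      choose c hc using hK z hz
      refine ⟨_, mem_Wsub.2 ⟨c, rfl⟩, ?_⟩
      rw [← map_smul]
      congr 1
      ext j
      simp [hc]
    · rintro ⟨w, hw, rfl⟩
      obtain ⟨z', rfl⟩ := mem_Wsub.1 hw
      exact ⟨d • z', Matrix.dvd_mulVec K fun j => ⟨z' j, rfl⟩, map_smul _ _ _⟩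

end

/-- If `L A Σ` is the reduced matrix with blocks `d·I_r` and `K`, then the nullspace of `A` is the
image under `Σ` of the nullspace of `(d·I_r | K)`. -/
theorem map_ker_eq_map_Nsub {m n r : ℕ} (hrm : r ≤ m) (A : Matrix (Fin m) (Fin n) R)
    (L : (Matrix (Fin m) (Fin m) (FractionRing R))ˣ) (σ : Equiv.Perm (Fin n))
    (d : R) (K : Matrix (Fin r) (Fin (n - r)) R)
    (hZ : ∀ (i : Fin m) (j : Fin n),
      (L.val * A.map (algebraMap R (FractionRing R)) * σ.permMatrix (FractionRing R)) i j =
        if hi : (i : ℕ) < r then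
          (if hj : (j : ℕ) < r then
            (if (i : ℕ) = (j : ℕ) then algebraMap R (FractionRing R) d else 0)
          else algebraMap R (FractionRing R)
            (K ⟨(i : ℕ), hi⟩ ⟨(j : ℕ) - r, by have := j.isLt; omega⟩))
        else 0) :
    (LinearMap.ker A.mulVecLin).map (toFrac R n) =
      (Nsub R r n d K).map (((σ.permMatrix (FractionRing R)).mulVecLin).restrictScalars R) := by
  have hperm (y : Fin n → R) :
      σ.permMatrix (FractionRing R) *ᵥ toFrac R n y = toFrac R n (y ∘ σ) := by
    rw [Matrix.permMatrix_mulVec]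
    rfl
  have hker (y : Fin n → R) : A *ᵥ (y ∘ σ) = 0 ↔ Jmat R r n d K *ᵥ y = 0 := by
    have hZy (i : Fin m) :
        (L.val *ᵥ (A.map (algebraMap R (FractionRing R)) *ᵥ toFrac R n (y ∘ σ))) i =
          if hi : (i : ℕ) < r then
            algebraMap R (FractionRing R) ((Jmat R r n d K *ᵥ y) ⟨i, hi⟩) else 0 := by
      rw [← hperm, Matrix.mulVec_mulVec, Matrix.mulVec_mulVec]
      simp only [Matrix.mulVec, dotProduct, hZ]
      split_ifs with hi
      · rw [map_sum]
        refine Finset.sum_congr rfl fun j _ => ?_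
        rw [map_mul, toFrac_apply]
        congr 1
        simp only [Jmat]
        split_ifs <;> simp
      · simp
    constructor
    · intro hA
      have h0 : A.map (algebraMap R (FractionRing R)) *ᵥ toFrac R n (y ∘ σ) = 0 := by
        ext i
        rw [map_mulVec_toFrac, hA]
        simp
      ext i
      have := hZy ⟨i, by omega⟩
      rw [h0] at this
      simpa using this.symm
    · intro hJ
      have h0 : L.val *ᵥ (A.map (algebraMap R (FractionRing R)) *ᵥ toFrac R n (y ∘ σ)) = 0 := by
        ext i
        rw [hZy, hJ]
        simp
      have h1 := congrArg (L⁻¹.val *ᵥ ·) h0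
      simp only [Matrix.mulVec_mulVec, ← Matrix.mul_assoc, Units.inv_mul, Matrix.one_mul,
        Matrix.mulVec_zero] at h1
      ext i
      have := congrFun h1 i
      rw [map_mulVec_toFrac] at this
      simpa using this
  ext v
  simp only [Nsub, Submodule.mem_map, LinearMap.mem_ker, Matrix.mulVecLin_apply,
    exists_exists_and_eq_and, LinearMap.restrictScalars_apply, hperm, ← hker]
  exact ((σ.arrowCongr (Equiv.refl R)).exists_congr_left.trans (by rfl))

end NullspaceLattice

/-- **Corollary.** With the notation of the main theorem:
`U = S` iff `d` divides every entry of `K`; and `S = M` iff `gcd(d, q_i)` is a unit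
for all `1 ≤ i ≤ t` and, in addition, either `d` is a unit or `K` has rank `f`. -/
theorem corollary_U_eq_S_and_S_eq_M
    (R : Type*) [CommRing R] [IsDomain R] [IsPrincipalIdealRing R]
    (m n r : ℕ) (hr : 0 < r) (hrn : r < n)
    (A : Matrix (Fin m) (Fin n) R)
    (hrank : (A.map (algebraMap R (FractionRing R))).rank = r)
    (L : (Matrix (Fin m) (Fin m) (FractionRing R))ˣ) (σ : Equiv.Perm (Fin n))
    (d : R) (hd : d ≠ 0) (K : Matrix (Fin r) (Fin (n - r)) R)
    (hZ : ∀ (i : Fin m) (j : Fin n),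
      (L.val * A.map (algebraMap R (FractionRing R)) * σ.permMatrix (FractionRing R)) i j =
        if hi : (i : ℕ) < r then
          (if hj : (j : ℕ) < r then
            (if (i : ℕ) = (j : ℕ) then algebraMap R (FractionRing R) d else 0)
          else algebraMap R (FractionRing R)
            (K ⟨(i : ℕ), hi⟩ ⟨(j : ℕ) - r, by have := j.isLt; omega⟩))
        else 0)
    (P : (Matrix (Fin r) (Fin r) R)ˣ) (Q : (Matrix (Fin (n - r)) (Fin (n - r)) R)ˣ)
    (q : Fin (min r (n - r)) → R)
    (hqchain : ∀ i j, i ≤ j → q i ∣ q j)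
    (hsnf : P.val * K * Q.val = fun (i : Fin r) (j : Fin (n - r)) =>
      if h : (i : ℕ) = (j : ℕ) then q ⟨(i : ℕ), by have := i.isLt; have := j.isLt; omega⟩
      else 0)
    (t : ℕ) (htle : t ≤ min r (n - r))
    (ht : ∀ i : Fin (min r (n - r)), q i ≠ 0 ↔ (i : ℕ) < t)
    (S : Submodule R (Fin n → FractionRing R))
    (hS : S = (LinearMap.ker A.mulVecLin).map (toFrac R n))
    (U : Submodule R (Fin n → FractionRing R))
    (hU : U = (Wsub R r n d K).map
      (((σ.permMatrix (FractionRing R)).mulVecLin).restrictScalars R)) :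
    (U = S ↔ ∀ (i : Fin r) (j : Fin (n - r)), d ∣ K i j) ∧
    (S = d • U ↔
      ((∀ i : Fin t, IsCoprime d (q (Fin.castLE htle i))) ∧
        (IsUnit d ∨ t = n - r))) := by
  have hrm : r ≤ m := hrank ▸ (Matrix.rank_le_height _)
  have hinj : Function.Injective
      (Submodule.map (((σ.permMatrix (FractionRing R)).mulVecLin).restrictScalars R)) := by
    refine Submodule.map_injective_of_injective fun v w hvw => ?_
    simp only [LinearMap.restrictScalars_apply, Matrix.mulVecLin_apply,
      Matrix.permMatrix_mulVec] at hvw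
    exact σ.surjective.injective_comp_right hvw
  rw [hS, hU, map_ker_eq_map_Nsub hrm A L σ d K hZ, ← Submodule.map_pointwise_smul, hinj.eq_iff,
    hinj.eq_iff, Nsub_eq_smul_Wsub_iff hrn.le hd,
    dvd_of_dvd_mulVec_iff hd K P Q q hsnf t htle ht]
  exact ⟨Wsub_eq_Nsub_iff hrn.le hd, Iff.rfl⟩
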